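/- arXiv:2003.06684 — 2 statements merged into one kernel-verified Lean document; each statement's English description precedes it below -/
import Mathlib

section
/- Let p ∈ [1,∞) and let P₀ be a Borel probability measure on ℝ^d with finite p-th moment. For an i.i.d. sample X₁,…,Xₙ from P₀, let T_n = W_p^p(P̂_n, P₀) where P̂_n is the empirical distribution of the sample, let F_n(t) = P₀ⁿ[T_n ≤ t], and for α ∈ (0,1) let c(α,n,P₀) = inf{t > 0 : F_n(t) ≥ 1−α}. Then for every α ∈ (0,1), the critical values converge to zero: lim_{n→∞} c(α,n,P₀) = 0. -/
open MeasureTheory ENNReal Filter Topology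

noncomputable section

/-- `ℝ^d` as Euclidean space. -/
abbrev Euc (d : ℕ) : Type := EuclideanSpace ℝ (Fin d)

/-- The set of couplings of two Borel probability measures: probability measures on the
product space whose first marginal is `P` and second marginal is `Q`. -/
def couplings {E : Type*} [MeasurableSpace E] (P Q : Measure E) : Set (Measure (E × E)) :=
  {γ | IsProbabilityMeasure γ ∧ γ.map Prod.fst = P ∧ γ.map Prod.snd = Q}

/-- `W_p^p(P,Q)`: the `p`-th power of the `p`-Wasserstein distance,
`inf_{γ ∈ Γ(P,Q)} ∫ ‖x - y‖^p dγ(x,y)`, as an extended nonnegative real. -/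
def WpPow {E : Type*} [MeasurableSpace E] [NormedAddCommGroup E] (p : ℝ) (P Q : Measure E) :
    ℝ≥0∞ :=
  ⨅ γ ∈ couplings P Q, ∫⁻ z, ENNReal.ofReal (‖z.1 - z.2‖ ^ p) ∂γ

/-- The `p`-Wasserstein distance `W_p(P,Q)`. -/
def Wp {E : Type*} [MeasurableSpace E] [NormedAddCommGroup E] (p : ℝ) (P Q : Measure E) :
    ℝ≥0∞ :=
  WpPow p P Q ^ (1 / p)

/-- Empirical distribution `n⁻¹ ∑ᵢ δ_{x i}` of `n` points. -/
def empDist {E : Type*} [MeasurableSpace E] {n : ℕ} (x : Fin n → E) : Measure E :=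
  (n : ℝ≥0∞)⁻¹ • ∑ i, Measure.dirac (x i)

/-- The `n`-fold product measure `P^n` on `(ℝ^d)^n`. -/
def prodn {E : Type*} [MeasurableSpace E] (P : Measure E) (n : ℕ) : Measure (Fin n → E) :=
  Measure.pi fun _ => P

/-- `P` has a finite moment of order `p`. -/
def HasFinMom {E : Type*} [MeasurableSpace E] [NormedAddCommGroup E] (p : ℝ) (P : Measure E) :
    Prop :=
  ∫⁻ x, ENNReal.ofReal (‖x‖ ^ p) ∂P ≠ ∞


theorem coupling_bound {d : ℕ} {ι : Type} [Fintype ι] [MeasurableSpace ι] [MeasurableSingletonClass ι]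
    (p : ℝ) (hp : 1 ≤ p) (μ ν : Measure (Euc d)) [IsProbabilityMeasure μ] [IsProbabilityMeasure ν]
    (f : Euc d → ι) (hf : Measurable f) (j₀ : ι) (δ R : ℝ)
    (hdiam : ∀ x y, f x ≠ j₀ → f x = f y → ‖x - y‖ ≤ δ)
    (hR : ∀ x, f x ≠ j₀ → ‖x‖ ≤ R)
    (θ η : ℝ≥0∞) (hθη : θ + η = 1) (hθ : θ ≠ 0)
    (hab : ∀ j, θ * ν (f ⁻¹' {j}) ≤ μ (f ⁻¹' {j})) :
    WpPow p μ ν ≤ ENNReal.ofReal (δ ^ p) +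
      ENNReal.ofReal (2 ^ p) * (∫⁻ x in f ⁻¹' {j₀}, ENNReal.ofReal (‖x‖ ^ p) ∂μ +
        ∫⁻ x in f ⁻¹' {j₀}, ENNReal.ofReal (‖x‖ ^ p) ∂ν) +
      ENNReal.ofReal (2 ^ p) * (ENNReal.ofReal (R ^ p) * η +
        ∫⁻ x in f ⁻¹' {j₀}, ENNReal.ofReal (‖x‖ ^ p) ∂μ +
        η * ∫⁻ x, ENNReal.ofReal (‖x‖ ^ p) ∂ν) := by
  classical
  have hA : ∀ j, MeasurableSet (f ⁻¹' {j}) := fun j => hf (measurableSet_singleton j)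
  set A : ι → Set (Euc d) := fun j => f ⁻¹' {j} with hAdef
  have hsum : ∀ (m : Measure (Euc d)), ∑ j, m.restrict (A j) = m := by
    intro m
    ext s hs
    rw [Measure.finsetSum_apply]
    have h1 : ∀ j, m.restrict (A j) s = (m.restrict s) (f ⁻¹' {j}) := by
      intro j
      rw [Measure.restrict_apply hs, Measure.restrict_apply (hA j), Set.inter_comm]
    simp_rw [h1]
    rw [sum_measure_preimage_singleton _ (fun j _ => hA j)]
    simp
  have hsumA : ∀ (m : Measure (Euc d)) [IsProbabilityMeasure m], ∑ j, m (A j) = 1 := by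
    intro m _
    have := sum_measure_preimage_singleton (μ := m) (f := f) Finset.univ (fun j _ => hA j)
    simpa using this
  set w : ι → ℝ≥0∞ := fun j => if μ (A j) = 0 then 0 else θ * (μ (A j))⁻¹ with hw
  set c : ι → ℝ≥0∞ := fun j => 1 - w j * ν (A j) with hc
  have hν0 : ∀ j, μ (A j) = 0 → ν (A j) = 0 := by
    intro j h
    have h2 := hab j
    change θ * ν (A j) ≤ μ (A j) at h2
    rw [h] at h2
    have := le_antisymm h2 (zero_le)
    exact (mul_eq_zero.1 this).resolve_left hθ
  have haw : ∀ j, μ (A j) ≠ 0 → μ (A j) * w j = θ := by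
    intro j h
    simp only [hw, if_neg h]
    rw [mul_left_comm, ENNReal.mul_inv_cancel h (measure_ne_top _ _), mul_one]
  have hawθ : ∀ j, μ (A j) * w j ≤ θ := by
    intro j
    by_cases h : μ (A j) = 0
    · simp [h]
    · exact (haw j h).le
  have hθ1 : θ ≤ 1 := by rw [← hθη]; exact le_self_add
  have hθt : θ ≠ ∞ := ne_top_of_le_ne_top one_ne_top hθ1
  have hwb : ∀ j, w j * ν (A j) ≤ 1 := by
    intro j
    by_cases h : μ (A j) = 0
    · simp [hν0 j h]
    · calc w j * ν (A j) = (θ * ν (A j)) * (μ (A j))⁻¹ := by simp only [hw, if_neg h]; ring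
        _ ≤ μ (A j) * (μ (A j))⁻¹ := by gcongr; exact hab j
        _ = 1 := ENNReal.mul_inv_cancel h (measure_ne_top _ _)
  have hwc : ∀ j, w j * ν (A j) + c j = 1 := fun j => add_tsub_cancel_of_le (hwb j)
  have hc1 : ∀ j, c j ≤ 1 := fun j => tsub_le_self
  have hawb : ∀ j, μ (A j) * (w j * ν (A j)) = θ * ν (A j) := by
    intro j
    by_cases h : μ (A j) = 0
    · simp [hν0 j h]
    · rw [← mul_assoc, haw j h]
  have hac : ∑ j, μ (A j) * c j = η := by
    have h1 : θ + ∑ j, μ (A j) * c j = θ + η := by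
      rw [hθη]
      calc θ + ∑ j, μ (A j) * c j = θ * ∑ j, ν (A j) + ∑ j, μ (A j) * c j := by
            rw [hsumA ν, mul_one]
        _ = ∑ j, μ (A j) * (w j * ν (A j) + c j) := by
            rw [Finset.mul_sum, ← Finset.sum_add_distrib]
            refine Finset.sum_congr rfl fun j _ => ?_
            rw [mul_add, hawb]
        _ = 1 := by simp_rw [hwc, mul_one]; exact hsumA μ
    exact (ENNReal.add_right_inj hθt).1 h1
  have hνr : ∀ j, (μ (A j) * w j) • ν.restrict (A j) = θ • ν.restrict (A j) := by
    intro j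
    by_cases h : μ (A j) = 0
    · rw [Measure.restrict_eq_zero.2 (hν0 j h)]; simp
    · rw [haw j h]
  have hct : ∀ j, c j ≠ ∞ := fun j => ne_top_of_le_ne_top one_ne_top (hc1 j)
  have hwt : ∀ j, w j ≠ ∞ := by
    intro j
    by_cases h : μ (A j) = 0
    · simp [hw, h]
    · simp only [hw, if_neg h]
      exact ENNReal.mul_ne_top hθt (ENNReal.inv_ne_top.2 h)
  set κ : ι → Measure (Euc d) := fun j => w j • ν.restrict (A j) + c j • ν with hκ
  have hκfin : ∀ j, IsFiniteMeasure (κ j) := by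
    intro j
    have h1 := Measure.smul_finite (ν.restrict (A j)) (hwt j)
    have h2 := Measure.smul_finite ν (hct j)
    simp only [hκ]
    infer_instance
  have hκ1 : ∀ j, κ j Set.univ = 1 := by
    intro j
    simp [hκ, hwc j]
  set γ : Measure (Euc d × Euc d) := ∑ j, (μ.restrict (A j)).prod (κ j) with hγ
  have hfst : γ.map Prod.fst = μ := by
    rw [hγ, Measure.map_finset_sum' measurable_fst.aemeasurable]
    simp_rw [Measure.map_fst_prod, hκ1, one_smul]
    exact hsum μ
  have hsnd : γ.map Prod.snd = ν := by
    rw [hγ, Measure.map_finset_sum' measurable_snd.aemeasurable]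
    simp_rw [Measure.map_snd_prod, hκ, smul_add, smul_smul, Measure.restrict_apply_univ, hνr]
    rw [Finset.sum_add_distrib, ← Finset.smul_sum, hsum, ← Finset.sum_smul, hac, ← add_smul, hθη,
      one_smul]
  have hprob : IsProbabilityMeasure γ := by
    constructor
    have : (γ.map Prod.fst) Set.univ = 1 := by rw [hfst]; exact measure_univ
    rwa [Measure.map_apply measurable_fst MeasurableSet.univ] at this
  have hle : WpPow p μ ν ≤ ∫⁻ z, ENNReal.ofReal (‖z.1 - z.2‖ ^ p) ∂γ :=
    iInf₂_le γ ⟨hprob, hfst, hsnd⟩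
  refine hle.trans ?_
  have hmeas : Measurable fun z : Euc d × Euc d => ENNReal.ofReal (‖z.1 - z.2‖ ^ p) := by fun_prop
  have hGm : Measurable fun x : Euc d => ENNReal.ofReal (‖x‖ ^ p) := by fun_prop
  set G : Euc d → ℝ≥0∞ := fun x => ENNReal.ofReal (‖x‖ ^ p) with hG
  set C : ℝ≥0∞ := ENNReal.ofReal (2 ^ p) with hC
  have hgb : ∀ x y : Euc d, ENNReal.ofReal (‖x - y‖ ^ p) ≤ C * (G x + G y) := by
    intro x y
    simp only [hG, hC]
    rw [← ENNReal.ofReal_add (by positivity) (by positivity), ← ENNReal.ofReal_mul (by positivity)]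
    apply ENNReal.ofReal_le_ofReal
    have h1 : ‖x - y‖ ≤ 2 * max ‖x‖ ‖y‖ := by
      have := norm_sub_le x y
      have := le_max_left ‖x‖ ‖y‖
      have := le_max_right ‖x‖ ‖y‖
      linarith
    calc ‖x - y‖ ^ p ≤ (2 * max ‖x‖ ‖y‖) ^ p := by gcongr
      _ = 2 ^ p * (max ‖x‖ ‖y‖) ^ p := Real.mul_rpow (by norm_num) (by positivity)
      _ ≤ 2 ^ p * (‖x‖ ^ p + ‖y‖ ^ p) := by
        gcongr
        rcases max_choice ‖x‖ ‖y‖ with h | h <;> rw [h]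
        · have : 0 ≤ ‖y‖ ^ p := by positivity
          linarith
        · have : 0 ≤ ‖x‖ ^ p := by positivity
          linarith
  -- double integral bound
  have hdbl : ∀ (m m' : Measure (Euc d)) , 
      ∫⁻ x, ∫⁻ y, ENNReal.ofReal (‖x - y‖ ^ p) ∂m' ∂m ≤
        C * (m' Set.univ * ∫⁻ x, G x ∂m + m Set.univ * ∫⁻ y, G y ∂m') := by
    intro m m'
    calc ∫⁻ x, ∫⁻ y, ENNReal.ofReal (‖x - y‖ ^ p) ∂m' ∂m
        ≤ ∫⁻ x, ∫⁻ y, C * (G x + G y) ∂m' ∂m :=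
          lintegral_mono fun x => lintegral_mono fun y => hgb x y
      _ = _ := by
        have h1 : ∀ x, ∫⁻ y, C * (G x + G y) ∂m' = C * (m' Set.univ * G x + ∫⁻ y, G y ∂m') := by
          intro x
          rw [lintegral_const_mul _ (by fun_prop), lintegral_add_left measurable_const,
            lintegral_const, mul_comm (G x)]
        simp_rw [h1]
        rw [lintegral_const_mul _ (by fun_prop), lintegral_add_right _ measurable_const,
          lintegral_const, lintegral_const_mul _ hGm, mul_comm (∫⁻ y, G y ∂m')]
  have hexp : ∫⁻ z, ENNReal.ofReal (‖z.1 - z.2‖ ^ p) ∂γ =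
      ∑ j, (w j * ∫⁻ x in A j, ∫⁻ y in A j, ENNReal.ofReal (‖x - y‖ ^ p) ∂ν ∂μ) +
      ∑ j, (c j * ∫⁻ x in A j, ∫⁻ y, ENNReal.ofReal (‖x - y‖ ^ p) ∂ν ∂μ) := by
    rw [hγ, lintegral_finsetSum_measure, ← Finset.sum_add_distrib]
    refine Finset.sum_congr rfl fun j _ => ?_
    rw [lintegral_prod _ hmeas.aemeasurable]
    simp only [hκ, lintegral_add_measure, lintegral_smul_measure, smul_eq_mul]
    have hm1 : ∀ m : Measure (Euc d), IsFiniteMeasure m →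
        Measurable fun x => ∫⁻ y, ENNReal.ofReal (‖x - y‖ ^ p) ∂m := by
      intro m _
      exact hmeas.lintegral_prod_right'
    rw [lintegral_add_left ((hm1 _ inferInstance).const_mul _),
      lintegral_const_mul _ (hm1 _ inferInstance), lintegral_const_mul _ (hm1 _ inferInstance)]
  rw [hexp]
  set T := ∫⁻ x in A j₀, G x ∂μ with hT
  set T' := ∫⁻ x in A j₀, G x ∂ν with hT'
  have hfirst : ∑ j, (w j * ∫⁻ x in A j, ∫⁻ y in A j, ENNReal.ofReal (‖x - y‖ ^ p) ∂ν ∂μ) ≤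
      ENNReal.ofReal (δ ^ p) + C * (T + T') := by
    have h1 : ∀ j, w j * ∫⁻ x in A j, ∫⁻ y in A j, ENNReal.ofReal (‖x - y‖ ^ p) ∂ν ∂μ ≤
        ENNReal.ofReal (δ ^ p) * μ (A j) + if j = j₀ then C * (T + T') else 0 := by
      intro j
      by_cases hj : j = j₀
      · subst hj
        simp only [if_true]
        refine le_add_left ?_
        calc _ ≤ w j * (C * (ν (A j) * T + μ (A j) * T')) := by
              gcongr
              have := hdbl (μ.restrict (A j)) (ν.restrict (A j))
              simpa using this
          _ = C * ((w j * ν (A j)) * T + (μ (A j) * w j) * T') := by ring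
          _ ≤ C * (1 * T + 1 * T') := by
              gcongr
              · exact hwb j
              · exact (hawθ j).trans hθ1
          _ = _ := by simp
      · simp only [if_neg hj, add_zero]
        calc _ ≤ w j * ∫⁻ x in A j, ∫⁻ y in A j, ENNReal.ofReal (δ ^ p) ∂ν ∂μ := by
              refine mul_le_mul' le_rfl ?_
              refine setLIntegral_mono' (hA j) fun x hx => setLIntegral_mono' (hA j) fun y hy => ?_
              have hx' : f x = j := hx
              have hy' : f y = j := hy
              apply ENNReal.ofReal_le_ofReal
              have := hdiam x y (by rw [hx']; exact hj) (by rw [hx', hy'])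
              gcongr
          _ = ENNReal.ofReal (δ ^ p) * ((w j * ν (A j)) * μ (A j)) := by
              simp only [lintegral_const, Measure.restrict_apply_univ]; ring
          _ ≤ ENNReal.ofReal (δ ^ p) * (1 * μ (A j)) := by
              gcongr; exact hwb j
          _ = _ := by simp
    calc _ ≤ ∑ j, (ENNReal.ofReal (δ ^ p) * μ (A j) + if j = j₀ then C * (T + T') else 0) :=
          Finset.sum_le_sum fun j _ => h1 j
      _ = _ := by
        rw [Finset.sum_add_distrib, ← Finset.mul_sum, hsumA μ]; simp
  have hsecond : ∑ j, (c j * ∫⁻ x in A j, ∫⁻ y, ENNReal.ofReal (‖x - y‖ ^ p) ∂ν ∂μ) ≤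
      C * (ENNReal.ofReal (R ^ p) * η + T + η * ∫⁻ x, G x ∂ν) := by
    have h1 : ∀ j, c j * ∫⁻ x in A j, ∫⁻ y, ENNReal.ofReal (‖x - y‖ ^ p) ∂ν ∂μ ≤
        C * (ENNReal.ofReal (R ^ p) * (μ (A j) * c j) + (if j = j₀ then T else 0) +
          (μ (A j) * c j) * ∫⁻ x, G x ∂ν) := by
      intro j
      have hb : c j * ∫⁻ x in A j, G x ∂μ ≤
          ENNReal.ofReal (R ^ p) * (μ (A j) * c j) + (if j = j₀ then T else 0) := by
        by_cases hj : j = j₀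
        · subst hj
          simp only [if_true]
          refine le_add_left ?_
          calc _ ≤ 1 * T := by gcongr; exact hc1 j
            _ = T := one_mul _
        · simp only [if_neg hj, add_zero]
          calc _ ≤ c j * ∫⁻ x in A j, ENNReal.ofReal (R ^ p) ∂μ := by
                refine mul_le_mul' le_rfl ?_
                refine setLIntegral_mono' (hA j) fun x hx => ?_
                have hx' : f x = j := hx
                apply ENNReal.ofReal_le_ofReal
                have := hR x (by rw [hx']; exact hj)
                gcongr
            _ = _ := by simp only [lintegral_const, Measure.restrict_apply_univ]; ring
      calc _ ≤ c j * (C * (∫⁻ x in A j, G x ∂μ + μ (A j) * ∫⁻ x, G x ∂ν)) := by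
            refine mul_le_mul' le_rfl ?_
            have := hdbl (μ.restrict (A j)) ν
            simpa using this
        _ = C * (c j * ∫⁻ x in A j, G x ∂μ + (μ (A j) * c j) * ∫⁻ x, G x ∂ν) := by ring
        _ ≤ _ := by gcongr
    calc _ ≤ ∑ j, C * (ENNReal.ofReal (R ^ p) * (μ (A j) * c j) + (if j = j₀ then T else 0) +
          (μ (A j) * c j) * ∫⁻ x, G x ∂ν) := Finset.sum_le_sum fun j _ => h1 j
      _ = _ := by
        rw [← Finset.mul_sum, Finset.sum_add_distrib, Finset.sum_add_distrib, ← Finset.mul_sum,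
          ← Finset.sum_mul, hac]
        simp
  exact add_le_add hfirst hsecond

theorem exists_cells {d : ℕ} (P : Measure (Euc d)) [IsProbabilityMeasure P] (G : Euc d → ℝ≥0∞)
    (hG : ∫⁻ x, G x ∂P ≠ ∞) (δ : ℝ) (hδ : 0 < δ) (τ : ℝ≥0∞) (hτ : 0 < τ) :
    ∃ (N : ℕ) (f : Euc d → Fin (N + 1)) (R : ℝ), Measurable f ∧
      (∀ x y, f x ≠ Fin.last N → f x = f y → ‖x - y‖ ≤ δ) ∧
      (∀ x, f x ≠ Fin.last N → ‖x‖ ≤ R) ∧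
      ∫⁻ x in f ⁻¹' {Fin.last N}, G x ∂P ≤ τ := by
  classical
  set e := TopologicalSpace.denseSeq (Euc d)
  have hex : ∀ x : Euc d, ∃ k, x ∈ Metric.ball (e k) (δ / 2) := by
    intro x
    obtain ⟨k, hk⟩ := (TopologicalSpace.denseRange_denseSeq (Euc d)).exists_dist_lt x
      (half_pos hδ)
    exact ⟨k, hk⟩
  set g : Euc d → ℕ := fun x => Nat.find (hex x) with hg
  have hgm : Measurable g := measurable_find hex fun k => measurableSet_ball
  have hgs : ∀ x, dist x (e (g x)) < δ / 2 := fun x => Nat.find_spec (hex x)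
  set s : ℕ → Set (Euc d) := fun N => {x | N ≤ g x} with hs
  have hsm : ∀ N, MeasurableSet (s N) := fun N => hgm measurableSet_Ici
  have hlim : Tendsto (P ∘ s) atTop (𝓝 0) := by
    have h := tendsto_measure_iInter_atTop (μ := P) (s := s) (fun N => (hsm N).nullMeasurableSet)
      (fun a b hab x hx => le_trans hab hx) ⟨0, measure_ne_top _ _⟩
    have h0 : ⋂ n, s n = ∅ := by
      ext x
      simp only [Set.mem_iInter, Set.mem_empty_iff_false, iff_false, not_forall]
      exact ⟨g x + 1, by simp [hs]⟩
    rwa [h0, measure_empty] at h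
  have hlim2 := tendsto_setLIntegral_zero hG hlim
  obtain ⟨N, hN⟩ := (hlim2.eventually (ge_mem_nhds hτ)).exists
  refine ⟨N, fun x => ⟨min N (g x), by omega⟩, ∑ k ∈ Finset.range N, ‖e k‖ + δ, ?_, ?_, ?_, ?_⟩
  · exact (measurable_from_nat (f := fun m : ℕ => (⟨min N m, by omega⟩ : Fin (N + 1)))).comp hgm
  · intro x y hx hxy
    simp only [ne_eq, Fin.ext_iff, Fin.val_last] at hx hxy
    have h1 : g x = g y := by omega
    have h2 := hgs x
    have h3 := hgs y
    rw [← h1] at h3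
    rw [← dist_eq_norm]
    have := dist_triangle_right x y (e (g x))
    linarith
  · intro x hx
    simp only [ne_eq, Fin.ext_iff, Fin.val_last] at hx
    have h1 : g x < N := by omega
    have h2 := hgs x
    have h3 : ‖e (g x)‖ ≤ ∑ k ∈ Finset.range N, ‖e k‖ :=
      Finset.single_le_sum (f := fun k => ‖e k‖) (fun _ _ => norm_nonneg _) (Finset.mem_range.2 h1)
    rw [dist_eq_norm] at h2
    have h4 : ‖x‖ ≤ ‖x - e (g x)‖ + ‖e (g x)‖ := by
      simpa using norm_add_le (x - e (g x)) (e (g x))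
    linarith
  · have : (fun x => (⟨min N (g x), by omega⟩ : Fin (N + 1))) ⁻¹' {Fin.last N} = s N := by
      ext x
      simp [hs, Fin.ext_iff]
    rw [this]
    exact hN

theorem lintegral_empDist {E : Type*} [MeasurableSpace E] {n : ℕ} (x : Fin n → E)
    (g : E → ℝ≥0∞) (hg : Measurable g) :
    ∫⁻ y, g y ∂(empDist x) = (n : ℝ≥0∞)⁻¹ * ∑ i, g (x i) := by
  rw [empDist, lintegral_smul_measure, lintegral_finsetSum_measure]
  simp [lintegral_dirac' _ hg]

theorem markov_empDist {E : Type*} [MeasurableSpace E] (P : Measure E) [IsProbabilityMeasure P]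
    (n : ℕ) (hn : n ≠ 0) (g : E → ℝ≥0∞) (hg : Measurable g) (τ : ℝ≥0∞) :
    τ * prodn P n {x | τ ≤ ∫⁻ y, g y ∂(empDist x)} ≤ ∫⁻ y, g y ∂P := by
  simp_rw [lintegral_empDist _ g hg]
  have hm : ∀ i : Fin n, Measurable fun x : Fin n → E => g (x i) :=
    fun i => hg.comp (measurable_pi_apply i)
  refine (mul_meas_ge_le_lintegral ?_ τ).trans ?_
  · exact (Finset.measurable_fun_sum _ fun i _ => hm i).const_mul _
  rw [lintegral_const_mul _ (Finset.measurable_fun_sum _ fun i _ => hm i),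
    lintegral_finsetSum _ fun i _ => hm i]
  have h1 : ∀ i : Fin n, ∫⁻ x, g (x i) ∂(prodn P n) = ∫⁻ y, g y ∂P := by
    intro i
    exact (measurePreserving_eval (fun _ : Fin n => P) i).lintegral_comp hg
  simp_rw [h1]
  rw [Finset.sum_const, Finset.card_univ, Fintype.card_fin, nsmul_eq_mul, ← mul_assoc,
    ENNReal.inv_mul_cancel (by exact_mod_cast hn) (by simp), one_mul]

theorem empDist_lower {E : Type*} [MeasurableSpace E] (P : Measure E) [IsProbabilityMeasure P]
    (A : Set E) (hA : MeasurableSet A) (η : ℝ) (hη : 0 < η) (hη1 : η < 1) :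
    Tendsto (fun n : ℕ => prodn P n
      {x | ¬ (ENNReal.ofReal (1 - η) * P A ≤ empDist x A)}) atTop (𝓝 0) := by
  by_cases hb0 : P A = 0
  · simp [hb0]
  set b := P.real A with hb
  have hbpos : 0 < b := ENNReal.toReal_pos hb0 (measure_ne_top _ _)
  have hPA : P A = ENNReal.ofReal b := by rw [hb, ofReal_measureReal]
  set u : E → ℝ := A.indicator 1 with hu
  have hum : Measurable u := measurable_one.indicator hA
  have hu01 : ∀ y, u y ∈ Set.Icc (0 : ℝ) 1 := by
    intro y
    by_cases h : y ∈ A <;> simp [hu, h]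
  have huL : MemLp u 2 P := MemLp.of_bound hum.aestronglyMeasurable 1
    (Eventually.of_forall fun y => by
      rw [Real.norm_eq_abs, abs_of_nonneg (hu01 y).1]; exact (hu01 y).2)
  have hint : ∫ y, u y ∂P = b := by
    rw [hu, integral_indicator_one hA]
  have hbound : ∀ n : ℕ, n ≠ 0 → prodn P n
      {x | ¬ (ENNReal.ofReal (1 - η) * P A ≤ empDist x A)} ≤
      ENNReal.ofReal ((1 / (η * b) ^ 2) / n) := by
    intro n hn
    have hnpos : (0 : ℝ) < n := by positivity
    set S : (Fin n → E) → ℝ := ∑ i : Fin n, fun x => u (x i) with hS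
    have hSL : MemLp S 2 (Measure.pi fun _ : Fin n => P) :=
      memLp_finsetSum' _ fun i _ => huL.comp_measurePreserving (measurePreserving_eval _ i)
    have hES : ∫ x, S x ∂(Measure.pi fun _ : Fin n => P) = n * b := by
      simp only [hS, Finset.sum_apply]
      rw [integral_finsetSum]
      · have : ∀ i : Fin n, ∫ x, u (x i) ∂(Measure.pi fun _ : Fin n => P) = b := by
          intro i
          have h1 := integral_map (μ := Measure.pi fun _ : Fin n => P) (φ := Function.eval i)
            (measurable_pi_apply i).aemeasurable (f := u) hum.aestronglyMeasurable
          rw [(measurePreserving_eval (fun _ : Fin n => P) i).map_eq, hint] at h1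
          exact h1.symm
        simp [this]
      · intro i _
        exact (huL.comp_measurePreserving (measurePreserving_eval (fun _ : Fin n => P) i)).integrable
          (by norm_num)
    have hVar : ProbabilityTheory.variance S (Measure.pi fun _ : Fin n => P) ≤ n := by
      rw [hS, ProbabilityTheory.variance_sum_pi (X := fun _ => u) fun _ => huL]
      have : ProbabilityTheory.variance u P ≤ 1 :=
        (ProbabilityTheory.variance_le_sq_of_bounded (Eventually.of_forall hu01)
          hum.aemeasurable).trans (by norm_num)
      simp only [Finset.sum_const, Finset.card_univ, Fintype.card_fin, nsmul_eq_mul]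
      nlinarith
    have hcheb := ProbabilityTheory.meas_ge_le_variance_div_sq hSL (c := η * n * b) (by positivity)
    rw [hES] at hcheb
    refine (measure_mono ?_).trans (hcheb.trans ?_)
    · intro x hx
      simp only [Set.mem_ofPred_eq, not_le] at hx ⊢
      have he : empDist x A = ENNReal.ofReal (S x / n) := by
        have h1 := lintegral_empDist x (A.indicator 1) (measurable_one.indicator hA)
        rw [lintegral_indicator_one hA] at h1
        rw [h1, ENNReal.ofReal_div_of_pos hnpos, ENNReal.div_eq_inv_mul, ENNReal.ofReal_natCast]
        congr 1
        simp only [hS, Finset.sum_apply]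
        rw [ENNReal.ofReal_sum_of_nonneg fun i _ => (hu01 _).1]
        refine Finset.sum_congr rfl fun i _ => ?_
        by_cases h : x i ∈ A <;> simp [hu, h]
      rw [he, hPA, ← ENNReal.ofReal_mul (by linarith)] at hx
      have h2 := (ENNReal.ofReal_lt_ofReal_iff_of_nonneg (by
        have : 0 ≤ S x := by
          simp only [hS, Finset.sum_apply]
          exact Finset.sum_nonneg fun i _ => (hu01 _).1
        positivity)).1 hx
      rw [div_lt_iff₀ hnpos] at h2
      rw [abs_sub_comm]
      refine le_trans ?_ (le_abs_self _)
      nlinarith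
    · apply ENNReal.ofReal_le_ofReal
      calc _ ≤ (n : ℝ) / (η * n * b) ^ 2 := by gcongr
        _ = _ := by field_simp
  have hlim : Tendsto (fun n : ℕ => ENNReal.ofReal ((1 / (η * b) ^ 2) / n)) atTop (𝓝 0) := by
    have := ENNReal.tendsto_ofReal (tendsto_const_div_atTop_nhds_zero_nat (1 / (η * b) ^ 2))
    simpa using this
  refine tendsto_of_tendsto_of_tendsto_of_le_of_le' tendsto_const_nhds hlim
    (Eventually.of_forall fun _ => zero_le) ?_
  filter_upwards [eventually_ne_atTop 0] with n hn using hbound n hn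

/-- For a simple null hypothesis `P₀` with finite `p`-th moment, the critical
values `c(α, n, P₀) = inf {t > 0 : F_n(t) ≥ 1 - α}` of the Wasserstein GoF test statistic
`T_n = W_p^p(P̂_n, P₀)` tend to zero as `n → ∞`, for every `α ∈ (0,1)`. -/
theorem critical_values_tendsto_zero {d : ℕ} (p : ℝ) (hp : 1 ≤ p)
    (P₀ : Measure (Euc d)) [IsProbabilityMeasure P₀] (hmom : HasFinMom p P₀)
    (α : ℝ) (hα : α ∈ Set.Ioo (0 : ℝ) 1) :
    Tendsto (fun n : ℕ =>
        sInf {t : ℝ | 0 < t ∧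
          ENNReal.ofReal (1 - α) ≤
            prodn P₀ n {x | WpPow p (empDist x) P₀ ≤ ENNReal.ofReal t}})
      atTop (𝓝 0) := by
  have hp0 : 0 < p := by linarith
  obtain ⟨hα0, hα1⟩ := hα
  suffices h : ∀ t : ℝ, 0 < t → ∀ᶠ n : ℕ in atTop, ENNReal.ofReal (1 - α) ≤
      prodn P₀ n {x | WpPow p (empDist x) P₀ ≤ ENNReal.ofReal t} by
    rw [Metric.tendsto_nhds]
    intro ε hε
    filter_upwards [h (ε / 2) (half_pos hε)] with n hn
    have h1 := csInf_le (s := {t : ℝ | 0 < t ∧ ENNReal.ofReal (1 - α) ≤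
            prodn P₀ n {x | WpPow p (empDist x) P₀ ≤ ENNReal.ofReal t}}) (a := ε / 2)
      ⟨0, fun t ht => ht.1.le⟩ ⟨half_pos hε, hn⟩
    have h2 := Real.sInf_nonneg (s := {t : ℝ | 0 < t ∧ ENNReal.ofReal (1 - α) ≤
            prodn P₀ n {x | WpPow p (empDist x) P₀ ≤ ENNReal.ofReal t}}) (fun t ht => ht.1.le)
    rw [Real.dist_eq, sub_zero, abs_of_nonneg h2]
    linarith
  intro t ht
  have hGm : Measurable fun x : Euc d => ENNReal.ofReal (‖x‖ ^ p) := by fun_prop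
  set m : ℝ := (∫⁻ x, ENNReal.ofReal (‖x‖ ^ p) ∂P₀).toReal with hm
  have hm0 : 0 ≤ m := ENNReal.toReal_nonneg
  have hM : ∫⁻ x, ENNReal.ofReal (‖x‖ ^ p) ∂P₀ = ENNReal.ofReal m := (ENNReal.ofReal_toReal hmom).symm
  set C : ℝ := 2 ^ p with hC
  have hCpos : 0 < C := by positivity
  set τ : ℝ := t / (8 * C) with hτ
  have hτpos : 0 < τ := by positivity
  have hCτ : C * τ = t / 8 := by rw [hτ]; field_simp
  set δ : ℝ := (t / 4) ^ (1 / p) with hδ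
  have hδpos : 0 < δ := by positivity
  have hδp : δ ^ p = t / 4 := by
    rw [hδ, ← Real.rpow_mul (by positivity), one_div, inv_mul_cancel₀ hp0.ne', Real.rpow_one]
  obtain ⟨N, f, R₀, hf, hdiam, hR₀, hcell⟩ := exists_cells P₀ _ hmom δ hδpos
    (ENNReal.ofReal (τ * (α / 2))) (by rw [ENNReal.ofReal_pos]; positivity)
  set R := max R₀ 0 with hRdef
  have hR : ∀ x, f x ≠ Fin.last N → ‖x‖ ≤ R := fun x hx => (hR₀ x hx).trans (le_max_left _ _)
  have hR0 : 0 ≤ R := le_max_right _ _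
  have hRp : 0 ≤ R ^ p := by positivity
  set K := R ^ p + m + 1 with hK
  have hKpos : 0 < K := by positivity
  set η : ℝ := min (1 / 2) (t / (8 * C * K)) with hη
  have hηpos : 0 < η := by positivity
  have hη1 : η < 1 := (min_le_left _ _).trans_lt (by norm_num)
  have hηK : C * (η * K) ≤ t / 8 := by
    calc C * (η * K) ≤ C * (t / (8 * C * K) * K) := by gcongr; exact min_le_right _ _
      _ = t / 8 := by field_simp
  set A : Set (Euc d) := f ⁻¹' {Fin.last N} with hAdef
  have hA : MeasurableSet A := hf (measurableSet_singleton _)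
  set G : Euc d → ℝ≥0∞ := fun x => ENNReal.ofReal (‖x‖ ^ p) with hG
  have hlow : Tendsto (fun n : ℕ => ∑ j, prodn P₀ n
      {x | ¬ (ENNReal.ofReal (1 - η) * P₀ (f ⁻¹' {j}) ≤ empDist x (f ⁻¹' {j}))}) atTop (𝓝 0) := by
    have := tendsto_finsetSum (Finset.univ : Finset (Fin (N + 1))) fun j _ =>
      empDist_lower P₀ (f ⁻¹' {j}) (hf (measurableSet_singleton _)) η hηpos hη1
    simpa using this
  have hα2 : (0 : ℝ≥0∞) < ENNReal.ofReal (α / 2) := by rw [ENNReal.ofReal_pos]; positivity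
  filter_upwards [hlow.eventually (ge_mem_nhds hα2), eventually_ne_atTop 0] with n hn hn0
  have : IsProbabilityMeasure (prodn P₀ n) := by unfold prodn; infer_instance
  set S := {x : Fin n → Euc d | WpPow p (empDist x) P₀ ≤ ENNReal.ofReal t} with hS
  set B := {x : Fin n → Euc d | ENNReal.ofReal τ ≤ ∫⁻ y, A.indicator G y ∂(empDist x)} with hB
  have hBm : prodn P₀ n B ≤ ENNReal.ofReal (α / 2) := by
    have h1 := markov_empDist P₀ n hn0 (A.indicator G) (hGm.indicator hA) (ENNReal.ofReal τ)
    rw [lintegral_indicator hA] at h1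
    have h2 := h1.trans hcell
    rw [ENNReal.ofReal_mul hτpos.le] at h2
    exact (ENNReal.mul_le_mul_iff_right (by simpa using hτpos) ENNReal.ofReal_ne_top).1 h2
  have hsub : Sᶜ ⊆ B ∪ ⋃ j,
      {x | ¬ (ENNReal.ofReal (1 - η) * P₀ (f ⁻¹' {j}) ≤ empDist x (f ⁻¹' {j}))} := by
    intro x hx
    by_contra hcon
    apply hx
    simp only [Set.mem_union, Set.mem_iUnion, not_or, not_exists] at hcon
    obtain ⟨hc1, hc2⟩ := hcon
    have hc2' : ∀ j, ENNReal.ofReal (1 - η) * P₀ (f ⁻¹' {j}) ≤ empDist x (f ⁻¹' {j}) :=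
      fun j => not_not.1 (hc2 j)
    have hc1' : ∫⁻ y in A, G y ∂(empDist x) ≤ ENNReal.ofReal τ := by
      rw [← lintegral_indicator hA]
      exact (not_le.1 hc1).le
    have hprob : IsProbabilityMeasure (empDist x) := by
      constructor
      have h1 := lintegral_empDist x (fun _ => 1) measurable_const
      rw [lintegral_one] at h1
      rw [h1]
      simp [ENNReal.inv_mul_cancel (a := (n : ℝ≥0∞)) (by exact_mod_cast hn0) (by simp)]
    have hmain := coupling_bound p hp (empDist x) P₀ f hf (Fin.last N) δ R hdiam hR
      (ENNReal.ofReal (1 - η)) (ENNReal.ofReal η)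
      (by rw [← ENNReal.ofReal_add (by linarith) hηpos.le]; simp)
      (by simpa using hη1) hc2'
    refine hmain.trans ?_
    have hcell' : ∫⁻ y in A, G y ∂P₀ ≤ ENNReal.ofReal τ := by
      refine hcell.trans (ENNReal.ofReal_le_ofReal ?_)
      nlinarith
    calc _ ≤ ENNReal.ofReal (δ ^ p) + ENNReal.ofReal C * (ENNReal.ofReal τ + ENNReal.ofReal τ) +
          ENNReal.ofReal C * (ENNReal.ofReal (R ^ p) * ENNReal.ofReal η + ENNReal.ofReal τ +
            ENNReal.ofReal η * ENNReal.ofReal m) := by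
          rw [hM]
          gcongr
      _ = ENNReal.ofReal (δ ^ p + C * (τ + τ) + C * (R ^ p * η + τ + η * m)) := by
          rw [ENNReal.ofReal_add (by positivity) (by positivity),
            ENNReal.ofReal_add (by positivity) (by positivity),
            ENNReal.ofReal_mul (by positivity), ENNReal.ofReal_mul (by positivity),
            ENNReal.ofReal_add (by positivity) (by positivity),
            ENNReal.ofReal_add (by positivity) (by positivity),
            ENNReal.ofReal_add (by positivity) (by positivity),
            ENNReal.ofReal_mul (by positivity), ENNReal.ofReal_mul (by positivity)]
      _ ≤ ENNReal.ofReal t := by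
          apply ENNReal.ofReal_le_ofReal
          rw [hδp]
          have : C * (R ^ p * η + η * m) ≤ C * (η * K) := by
            gcongr
            rw [hK]
            nlinarith
          nlinarith
  have hSc : prodn P₀ n Sᶜ ≤ ENNReal.ofReal α := by
    calc _ ≤ prodn P₀ n B + ∑ j, prodn P₀ n
          {x | ¬ (ENNReal.ofReal (1 - η) * P₀ (f ⁻¹' {j}) ≤ empDist x (f ⁻¹' {j}))} :=
          (measure_mono hsub).trans ((measure_union_le _ _).trans
            (add_le_add le_rfl (measure_iUnion_fintype_le _ _)))
      _ ≤ ENNReal.ofReal (α / 2) + ENNReal.ofReal (α / 2) := add_le_add hBm hn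
      _ = ENNReal.ofReal α := by
          rw [← ENNReal.ofReal_add (by positivity) (by positivity), add_halves]
  have h1 : (1 : ℝ≥0∞) ≤ prodn P₀ n S + ENNReal.ofReal α := by
    calc (1 : ℝ≥0∞) = prodn P₀ n (S ∪ Sᶜ) := by rw [Set.union_compl_self, measure_univ]
      _ ≤ _ := (measure_union_le _ _).trans (add_le_add le_rfl hSc)
  rw [ENNReal.ofReal_sub _ hα0.le, ENNReal.ofReal_one]
  exact tsub_le_iff_right.2 h1
end
end

section
/- (Consistency of the Wasserstein test for a simple null hypothesis.) Let p ∈ [1,∞) and let P₀ be a Borel probability measure on ℝ^d with finite p-th moment. For an i.i.d. sample X₁,…,Xₙ from a Borel probability measure P on ℝ^d with empirical distribution P̂_n, let T_n = W_p^p(P̂_n, P₀), let F_n(t) = P₀ⁿ[T_n ≤ t] be the distribution function of T_n under sampling from P₀, and for α ∈ (0,1) let c(α,n,P₀) = inf{t > 0 : F_n(t) ≥ 1−α}. If P ≠ P₀, then for every α ∈ (0,1), lim_{n→∞} Pⁿ[T_n ≥ c(α,n,P₀)] = 1. -/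
open MeasureTheory ENNReal Filter Topology

noncomputable section

theorem emp_integral {E : Type*} [MeasurableSpace E] {n : ℕ} (x : Fin n → E) (f : E → ℝ)
    (hf : Measurable f) : ∫ z, f z ∂(empDist x) = (∑ i, f (x i)) / n := by
  unfold empDist
  rw [integral_smul_measure, integral_finsetSum_measure]
  · simp only [integral_dirac' _ _ hf.stronglyMeasurable, smul_eq_mul, ENNReal.toReal_inv,
      ENNReal.toReal_natCast]
    rw [div_eq_inv_mul]
  · intro i _
    exact (integrable_dirac' hf.stronglyMeasurable (by simp))

theorem emp_integrable {E : Type*} [MeasurableSpace E] {n : ℕ} (hn : 0 < n) (x : Fin n → E)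
    (f : E → ℝ) (hf : Measurable f) : Integrable f (empDist x) := by
  unfold empDist
  refine Integrable.smul_measure ?_ (by simp; omega)
  rw [integrable_finsetSum_measure]
  intro i _
  exact (integrable_dirac' hf.stronglyMeasurable (by simp))

theorem emp_prob {E : Type*} [MeasurableSpace E] {n : ℕ} (hn : 0 < n) (x : Fin n → E) :
    IsProbabilityMeasure (empDist x) := by
  constructor
  simp [empDist]
  exact ENNReal.inv_mul_cancel (by simp; omega) (by simp)

theorem prodn_eq_map {E : Type*} [MeasurableSpace E] (P : Measure E) [IsProbabilityMeasure P]
    (n : ℕ) : prodn P n = (Measure.infinitePi (fun _ : ℕ => P)).map (fun ω (i : Fin n) => ω i) := by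
  have h := (ProbabilityTheory.iIndepFun_infinitePi (P := fun _ : ℕ => P) (X := fun _ ω => ω)
    (by fun_prop)).precomp (Fin.val_injective (n := n))
  have h2 := (ProbabilityTheory.iIndepFun_iff_map_fun_eq_pi_map
    (fun i => (measurable_pi_apply _).aemeasurable)).1 h
  rw [h2]
  unfold prodn
  congr 1
  ext1 i
  exact (Measure.infinitePi_map_eval (fun _ : ℕ => P) i).symm

theorem wlln {E : Type*} [MeasurableSpace E] (P : Measure E) [IsProbabilityMeasure P]
    (f : E → ℝ) (hf : Measurable f) (hi : Integrable f P) (η : ℝ) (hη : 0 < η) :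
    Tendsto (fun n : ℕ => prodn P n {x | η ≤ |∫ z, f z ∂(empDist x) - ∫ z, f z ∂P|})
      atTop (𝓝 0) := by
  set μ := Measure.infinitePi (fun _ : ℕ => P)
  have mp : ∀ i, MeasurePreserving (fun ω : ℕ → E => ω i) μ P := fun i =>
    measurePreserving_eval_infinitePi (fun _ : ℕ => P) i
  have hind := (ProbabilityTheory.iIndepFun_infinitePi (P := fun _ : ℕ => P) (X := fun _ ω => f ω)
    (by fun_prop))
  have key := ProbabilityTheory.strong_law_ae_real (μ := μ) (fun i ω => f (ω i))
    ((mp 0).integrable_comp_of_integrable hi) (fun i j hij => hind.indepFun hij)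
    (fun i => by
      refine ⟨(hf.comp (measurable_pi_apply i)).aemeasurable,
        (hf.comp (measurable_pi_apply 0)).aemeasurable, ?_⟩
      have h : ∀ i, μ.map (fun ω => f (ω i)) = P.map f := fun i => by
        rw [← (mp i).map_eq, Measure.map_map hf (mp i).measurable]; rfl
      rw [h i, h 0])
  have hint : ∫ ω, f (ω 0) ∂μ = ∫ z, f z ∂P := by
    rw [← (mp 0).map_eq, integral_map (mp 0).measurable.aemeasurable hf.aestronglyMeasurable]
  rw [hint] at key
  have t := tendstoInMeasure_of_tendsto_ae (fun n => by
    refine Measurable.aestronglyMeasurable ?_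
    exact (Finset.measurable_sum _ fun i _ => hf.comp (measurable_pi_apply i)).div_const _) key
  rw [tendstoInMeasure_iff_dist] at t
  refine (t η hη).congr fun n => ?_
  rw [prodn_eq_map, Measure.map_apply (by fun_prop)]
  · congr 1
    ext ω
    simp only [Set.mem_ofPred_eq, Set.mem_preimage, emp_integral _ _ hf, Real.dist_eq]
    rw [Finset.sum_range fun i => f (ω i)]
  · simp only [emp_integral _ _ hf]
    refine measurableSet_le measurable_const (Measurable.abs ?_)
    refine Measurable.sub_const (Measurable.div_const ?_ _) _
    exact Finset.measurable_sum _ fun i _ => hf.comp (measurable_pi_apply i)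

theorem sum_smul_cond {E ι : Type*} [MeasurableSpace E] [Fintype ι] [DecidableEq ι]
    [MeasurableSpace ι] [MeasurableSingletonClass ι] (Q : Measure E)
    [IsProbabilityMeasure Q] (k : E → ι) (hk : Measurable k) :
    ∑ i, Q (k ⁻¹' {i}) • ((Q (k ⁻¹' {i}))⁻¹ • Q.restrict (k ⁻¹' {i})) = Q := by
  ext s hs
  simp only [Measure.coe_finsetSum, Finset.sum_apply, Measure.smul_apply, smul_eq_mul]
  have : ∀ i, Q (k ⁻¹' {i}) * ((Q (k ⁻¹' {i}))⁻¹ * Q.restrict (k ⁻¹' {i}) s)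
      = Q (s ∩ k ⁻¹' {i}) := by
    intro i
    rw [Measure.restrict_apply hs, ← mul_assoc]
    by_cases h : Q (k ⁻¹' {i}) = 0
    · rw [h, zero_mul, zero_mul, measure_mono_null Set.inter_subset_right h]
    · rw [ENNReal.mul_inv_cancel h (measure_ne_top _ _), one_mul]
  simp only [this]
  rw [← measure_biUnion_finset]
  · congr 1; ext x; simp
  · intro i _ j _ hij
    refine Set.disjoint_left.2 ?_
    rintro x ⟨_, h1⟩ ⟨_, h2⟩
    exact hij (h1.symm.trans h2)
  · intro i _
    exact hs.inter (hk (measurableSet_singleton i))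

theorem exists_coupling {E ι : Type*} [MeasurableSpace E] [Fintype ι] [DecidableEq ι]
    [MeasurableSpace ι] [MeasurableSingletonClass ι] (Q1 Q2 : Measure E)
    [IsProbabilityMeasure Q1] [IsProbabilityMeasure Q2] (k : E → ι) (hk : Measurable k) :
    ∃ γ ∈ couplings Q1 Q2, γ {z | k z.1 ≠ k z.2} ≤
      ∑ i, (Q2 (k ⁻¹' {i}) - Q1 (k ⁻¹' {i})) := by
  set a : ι → ℝ≥0∞ := fun i => Q1 (k ⁻¹' {i}) with ha
  set b : ι → ℝ≥0∞ := fun i => Q2 (k ⁻¹' {i}) with hb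
  have hat : ∀ i, a i ≠ ∞ := fun i => measure_ne_top _ _
  have hbt : ∀ i, b i ≠ ∞ := fun i => measure_ne_top _ _
  have hA : ∀ i, MeasurableSet (k ⁻¹' {i}) := fun i => hk (measurableSet_singleton i)
  have hsa : ∀ (Q : Measure E) [IsProbabilityMeasure Q], ∑ i, Q (k ⁻¹' {i}) = 1 := by
    intro Q _
    rw [← measure_biUnion_finset]
    · rw [← measure_univ (μ := Q)]; congr 1; ext x; simp
    · intro i _ j _ hij
      refine Set.disjoint_left.2 ?_
      intro x h1 h2
      exact hij (h1.symm.trans h2)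
    · intro i _
      exact hA i
  have h1 : ∀ i, min (a i) (b i) + (a i - b i) = a i := by
    intro i
    rcases le_total (a i) (b i) with h | h
    · rw [min_eq_left h, tsub_eq_zero_of_le h, add_zero]
    · rw [min_eq_right h, add_tsub_cancel_of_le h]
  have h2 : ∀ i, min (a i) (b i) + (b i - a i) = b i := by
    intro i
    rcases le_total (a i) (b i) with h | h
    · rw [min_eq_left h, add_tsub_cancel_of_le h]
    · rw [min_eq_right h, tsub_eq_zero_of_le h, add_zero]
  set r := ∑ i, (b i - a i) with hr
  have hmt : ∑ i, min (a i) (b i) ≠ ∞ :=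
    ENNReal.sum_ne_top.2 fun i _ => ne_top_of_le_ne_top (hat i) (min_le_left _ _)
  have hr' : ∑ i, (a i - b i) = r := by
    have e1 : ∑ i, min (a i) (b i) + ∑ i, (a i - b i) = 1 := by
      rw [← Finset.sum_add_distrib]; simp only [h1]; exact hsa Q1
    have e2 : ∑ i, min (a i) (b i) + r = 1 := by
      rw [hr, ← Finset.sum_add_distrib]; simp only [h2]; exact hsa Q2
    exact (ENNReal.add_right_inj hmt).1 (e1.trans e2.symm)
  have hrt : r ≠ ∞ := ENNReal.sum_ne_top.2 fun i _ => ne_top_of_le_ne_top (hbt i) tsub_le_self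
  set C : ι → Measure E := fun i => (a i)⁻¹ • Q1.restrict (k ⁻¹' {i}) with hC
  set D : ι → Measure E := fun i => (b i)⁻¹ • Q2.restrict (k ⁻¹' {i}) with hD
  have hCu : ∀ i, a i ≠ 0 → C i Set.univ = 1 := by
    intro i hi
    simp only [hC, Measure.smul_apply, Measure.restrict_apply_univ, smul_eq_mul]
    exact ENNReal.inv_mul_cancel hi (hat i)
  have hDu : ∀ i, b i ≠ 0 → D i Set.univ = 1 := by
    intro i hi
    simp only [hD, Measure.smul_apply, Measure.restrict_apply_univ, smul_eq_mul]
    exact ENNReal.inv_mul_cancel hi (hbt i)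
  have hCf : ∀ i, IsFiniteMeasure (C i) := by
    intro i
    by_cases hi : a i = 0
    · have : C i = 0 := by simp only [hC]; rw [Measure.restrict_eq_zero.2 hi, smul_zero]
      rw [this]; infer_instance
    · exact ⟨by rw [hCu i hi]; simp⟩
  have hDf : ∀ i, IsFiniteMeasure (D i) := by
    intro i
    by_cases hi : b i = 0
    · have : D i = 0 := by simp only [hD]; rw [Measure.restrict_eq_zero.2 hi, smul_zero]
      rw [this]; infer_instance
    · exact ⟨by rw [hDu i hi]; simp⟩
  set μ : Measure E := ∑ i, (a i - b i) • C i with hμ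
  set ν : Measure E := ∑ i, (b i - a i) • D i with hν
  have hμu : μ Set.univ = r := by
    rw [← hr', hμ]
    simp only [Measure.coe_finsetSum, Finset.sum_apply, Measure.smul_apply, smul_eq_mul]
    refine Finset.sum_congr rfl fun i _ => ?_
    by_cases hi : a i = 0
    · simp [hi]
    · rw [hCu i hi, mul_one]
  have hνu : ν Set.univ = r := by
    rw [hr, hν]
    simp only [Measure.coe_finsetSum, Finset.sum_apply, Measure.smul_apply, smul_eq_mul]
    refine Finset.sum_congr rfl fun i _ => ?_
    by_cases hi : b i = 0
    · simp [hi]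
    · rw [hDu i hi, mul_one]
  have hμf : IsFiniteMeasure μ := ⟨by rw [hμu]; exact hrt.lt_top⟩
  have hνf : IsFiniteMeasure ν := ⟨by rw [hνu]; exact hrt.lt_top⟩
  have hrr : ∀ m : Measure E, m Set.univ = r → r⁻¹ • r • m = m := by
    intro m hm
    by_cases h0 : r = 0
    · rw [h0, Measure.measure_univ_eq_zero] at hm
      rw [hm]; simp
    · rw [smul_smul, ENNReal.inv_mul_cancel h0 hrt, one_smul]
  set γ : Measure (E × E) := ∑ i, min (a i) (b i) • (C i).prod (D i) + r⁻¹ • μ.prod ν with hγ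
  have hm1 : γ.map Prod.fst = Q1 := by
    rw [hγ, Measure.map_add _ _ measurable_fst, Measure.map_smul, Measure.map_fst_prod, hνu,
      hrr μ hμu, ← Measure.mapₗ_apply_of_measurable measurable_fst, map_sum]
    simp only [Measure.mapₗ_apply_of_measurable measurable_fst, Measure.map_smul,
      Measure.map_fst_prod]
    rw [hμ, ← Finset.sum_add_distrib]
    conv_rhs => rw [← sum_smul_cond Q1 k hk]
    refine Finset.sum_congr rfl fun i _ => ?_
    change _ = a i • C i
    conv_rhs => rw [← h1 i, add_smul]
    congr 1
    by_cases hi : b i = 0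
    · simp [hi]
    · rw [hDu i hi, one_smul]
  have hm2 : γ.map Prod.snd = Q2 := by
    rw [hγ, Measure.map_add _ _ measurable_snd, Measure.map_smul, Measure.map_snd_prod, hμu,
      hrr ν hνu, ← Measure.mapₗ_apply_of_measurable measurable_snd, map_sum]
    simp only [Measure.mapₗ_apply_of_measurable measurable_snd, Measure.map_smul,
      Measure.map_snd_prod]
    rw [hν, ← Finset.sum_add_distrib]
    conv_rhs => rw [← sum_smul_cond Q2 k hk]
    refine Finset.sum_congr rfl fun i _ => ?_
    change _ = b i • D i
    conv_rhs => rw [← h2 i, add_smul]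
    congr 1
    by_cases hi : a i = 0
    · simp [hi]
    · rw [hCu i hi, one_smul]
  refine ⟨γ, ⟨⟨?_⟩, hm1, hm2⟩, ?_⟩
  · rw [← measure_univ (μ := Q1), ← hm1, Measure.map_apply measurable_fst MeasurableSet.univ,
      Set.preimage_univ]
  · have hz : ∀ i, (C i).prod (D i) {z | k z.1 ≠ k z.2} = 0 := by
      intro i
      have hc : C i (k ⁻¹' {i})ᶜ = 0 := by
        simp [hC, Measure.restrict_apply (hA i).compl]
      have hd : D i (k ⁻¹' {i})ᶜ = 0 := by
        simp [hD, Measure.restrict_apply (hA i).compl]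
      have hsub : {z : E × E | k z.1 ≠ k z.2} ⊆
          ((k ⁻¹' {i})ᶜ ×ˢ Set.univ) ∪ (Set.univ ×ˢ (k ⁻¹' {i})ᶜ) := by
        rintro ⟨x, y⟩ h
        simp only [Set.mem_ofPred_eq] at h
        by_cases hx : k x = i
        · right; simp; intro hy; exact h (hx.trans hy.symm)
        · left; simpa using hx
      refine measure_mono_null hsub (measure_union_null ?_ ?_)
      · rw [Measure.prod_prod, hc, zero_mul]
      · rw [Measure.prod_prod, hd, mul_zero]
    rw [hγ]
    simp only [Measure.add_apply, Measure.coe_finsetSum, Finset.sum_apply, Measure.smul_apply, hz,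
      smul_eq_mul, mul_zero, Finset.sum_const_zero, zero_add]
    calc r⁻¹ * (μ.prod ν) {z | k z.1 ≠ k z.2} ≤ r⁻¹ * (r * r) := by
          gcongr
          refine (measure_mono (Set.subset_univ _)).trans ?_
          rw [← Set.univ_prod_univ, Measure.prod_prod, hμu, hνu]
      _ ≤ r := by
          rw [← mul_assoc]
          refine (mul_le_mul_left (ENNReal.inv_mul_le_one r) r).trans ?_
          rw [one_mul]

theorem sep_fun {E : Type*} [PseudoMetricSpace E] [MeasurableSpace E] [BorelSpace E]
    (P Q : Measure E) [IsProbabilityMeasure P] [IsProbabilityMeasure Q] (h : P ≠ Q) :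
    ∃ (f : E → ℝ) (L : NNReal), LipschitzWith L f ∧ (∀ x, |f x| ≤ 1) ∧
      ∫ x, f x ∂P ≠ ∫ x, f x ∂Q := by
  by_contra hc
  push Not at hc
  apply h
  refine ext_of_generate_finite {s | IsClosed s}
    (by rw [BorelSpace.measurable_eq (α := E), borel_eq_generateFrom_isClosed])
    isPiSystem_isClosed (fun F hF => ?_) (by simp)
  have hpos : ∀ n : ℕ, (0 : ℝ) < 1 / ((n : ℝ) + 1) := fun n => by positivity
  have t1 := tendsto_integral_thickenedIndicator_of_isClosed P hF hpos
    tendsto_one_div_add_atTop_nhds_zero_nat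
  have t2 := tendsto_integral_thickenedIndicator_of_isClosed Q hF hpos
    tendsto_one_div_add_atTop_nhds_zero_nat
  have e : ∀ n, ∫ ω, (thickenedIndicator (hpos n) F ω : ℝ) ∂P
      = ∫ ω, (thickenedIndicator (hpos n) F ω : ℝ) ∂Q := by
    intro n
    refine hc _ (1 * (1 / ((n : ℝ) + 1)).toNNReal⁻¹)
      (NNReal.isometry_coe.lipschitz.comp (lipschitzWith_thickenedIndicator (hpos n) F)) ?_
    intro x
    simpa using thickenedIndicator_le_one (hpos n) F x
  simp only [e] at t1
  have := tendsto_nhds_unique t1 t2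
  exact (ENNReal.toReal_eq_toReal_iff' (measure_ne_top _ _) (measure_ne_top _ _)).1 this

theorem lower_bd {E : Type*} [NormedAddCommGroup E] [MeasurableSpace E] [BorelSpace E]
    [SecondCountableTopology E] (p : ℝ) (hp : 1 ≤ p)
    (f : E → ℝ) (L : NNReal) (hf : LipschitzWith L f) (hb : ∀ x, |f x| ≤ 1)
    (η : ℝ) (hη : 0 < η) : ∃ ε : ℝ, 0 < ε ∧ ∀ Q1 Q2 : Measure E,
      IsProbabilityMeasure Q1 → IsProbabilityMeasure Q2 →
      η ≤ |∫ x, f x ∂Q1 - ∫ x, f x ∂Q2| → ENNReal.ofReal ε ≤ WpPow p Q1 Q2 := by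
  set K : ℝ := L + 1 with hK
  have hKpos : 0 < K := by positivity
  set δ : ℝ := η / (2 * K) with hδ
  have hδpos : 0 < δ := by positivity
  set M : ℝ := K * δ ^ (1 - p) with hM
  have hMpos : 0 < M := by positivity
  have pt : ∀ t : ℝ, 0 ≤ t → K * t ≤ η / 2 + M * t ^ p := by
    intro t ht
    rcases le_total t δ with h | h
    · have : K * t ≤ η / 2 := by
        calc K * t ≤ K * δ := by gcongr
          _ = η / 2 := by rw [hδ]; field_simp
      have : 0 ≤ M * t ^ p := by positivity
      linarith
    · have htpos : 0 < t := hδpos.trans_le h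
      have e : t = t ^ (1 - p) * t ^ p := by
        rw [← Real.rpow_add htpos]; simp
      have : t ^ (1 - p) ≤ δ ^ (1 - p) :=
        Real.rpow_le_rpow_of_nonpos hδpos h (by linarith)
      have : K * t ≤ M * t ^ p := by
        calc K * t = K * (t ^ (1 - p) * t ^ p) := by rw [← e]
          _ ≤ K * (δ ^ (1 - p) * t ^ p) := by gcongr
          _ = M * t ^ p := by rw [hM]; ring
      linarith
  have hfm : Measurable f := hf.continuous.measurable
  refine ⟨η / 2 / M, by positivity, fun Q1 Q2 _ _ hd => ?_⟩
  unfold WpPow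
  refine le_iInf₂ fun γ hγ => ?_
  obtain ⟨hγp, m1, m2⟩ := hγ
  have hbd : ∀ (μ : Measure E) [IsProbabilityMeasure μ], Integrable f μ := fun μ _ =>
    .of_bound hfm.aestronglyMeasurable 1 (ae_of_all _ fun x => by simpa using hb x)
  have e1 : ∫ x, f x ∂Q1 = ∫ z, f z.1 ∂γ := by
    rw [← m1, integral_map measurable_fst.aemeasurable hfm.aestronglyMeasurable]
  have e2 : ∫ x, f x ∂Q2 = ∫ z, f z.2 ∂γ := by
    rw [← m2, integral_map measurable_snd.aemeasurable hfm.aestronglyMeasurable]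
  have i1 : Integrable (fun z : E × E => f z.1) γ :=
    .of_bound (hfm.comp measurable_fst).aestronglyMeasurable 1
      (ae_of_all _ fun x => by simpa using hb x.1)
  have i2 : Integrable (fun z : E × E => f z.2) γ :=
    .of_bound (hfm.comp measurable_snd).aestronglyMeasurable 1
      (ae_of_all _ fun x => by simpa using hb x.2)
  rw [e1, e2, ← integral_sub i1 i2] at hd
  have hmeas : Measurable fun z : E × E => ENNReal.ofReal (‖z.1 - z.2‖ ^ p) := by fun_prop
  set T := ∫⁻ z, ENNReal.ofReal (‖z.1 - z.2‖ ^ p) ∂γ with hT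
  have main : ENNReal.ofReal η ≤ ENNReal.ofReal (η / 2) + ENNReal.ofReal M * T := by
    calc ENNReal.ofReal η ≤ ‖∫ z, (f z.1 - f z.2) ∂γ‖ₑ := by
          rw [← ofReal_norm]; exact ENNReal.ofReal_le_ofReal hd
      _ ≤ ∫⁻ z, ‖f z.1 - f z.2‖ₑ ∂γ := enorm_integral_le_lintegral_enorm _
      _ ≤ ∫⁻ z, (ENNReal.ofReal (η / 2) +
            ENNReal.ofReal M * ENNReal.ofReal (‖z.1 - z.2‖ ^ p)) ∂γ := by
          refine lintegral_mono fun z => ?_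
          rw [← ENNReal.ofReal_mul hMpos.le, ← ENNReal.ofReal_add (by positivity) (by positivity),
            ← ofReal_norm]
          refine ENNReal.ofReal_le_ofReal ?_
          refine le_trans ?_ (pt _ (norm_nonneg _))
          have := hf.dist_le_mul z.1 z.2
          rw [dist_eq_norm, dist_eq_norm] at this
          refine this.trans ?_
          gcongr
          rw [hK]; linarith
      _ = _ := by
          rw [lintegral_add_left measurable_const, lintegral_const_mul _ hmeas,
            lintegral_const, measure_univ, mul_one]
  by_cases hTt : T = ∞
  · rw [hTt]; exact le_top
  rw [← ENNReal.ofReal_toReal hTt] at main ⊢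
  rw [← ENNReal.ofReal_mul hMpos.le, ← ENNReal.ofReal_add (by positivity) (by positivity),
    ENNReal.ofReal_le_ofReal_iff (by positivity)] at main
  refine ENNReal.ofReal_le_ofReal ?_
  rw [div_le_iff₀ hMpos]
  linarith

theorem upper_bd {E ι : Type*} [NormedAddCommGroup E] [MeasurableSpace E] [BorelSpace E]
    [SecondCountableTopology E] [Fintype ι] [DecidableEq ι]
    [MeasurableSpace ι] [MeasurableSingletonClass ι] (p : ℝ) (hp : 1 ≤ p) (Q1 Q2 : Measure E)
    [IsProbabilityMeasure Q1] [IsProbabilityMeasure Q2] (k : E → ι) (hk : Measurable k) (o : ι)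
    (δ R : ℝ) (hδ : 0 ≤ δ) (hR : 0 ≤ R)
    (hcell : ∀ x y, k x = k y → k x ≠ o → ‖x - y‖ ≤ δ) (hRb : ∀ x, k x ≠ o → ‖x‖ ≤ R) :
    WpPow p Q1 Q2 ≤ ENNReal.ofReal (δ ^ p) +
      ENNReal.ofReal (2 ^ p * (2 * R ^ p)) * ∑ i, (Q2 (k ⁻¹' {i}) - Q1 (k ⁻¹' {i})) +
      ENNReal.ofReal (2 ^ p) * (∫⁻ x, ENNReal.ofReal (if k x = o then ‖x‖ ^ p else 0) ∂Q1 +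
        ∫⁻ x, ENNReal.ofReal (if k x = o then ‖x‖ ^ p else 0) ∂Q2) := by
  obtain ⟨γ, hγ, hγb⟩ := exists_coupling Q1 Q2 k hk
  have hγ' := hγ
  obtain ⟨hγp, m1, m2⟩ := hγ'
  set G : E → ℝ := fun x => if k x = o then ‖x‖ ^ p else 0 with hG
  have hG0 : ∀ x, 0 ≤ G x := fun x => by simp only [hG]; split_ifs <;> positivity
  have hGm : Measurable G := by
    refine Measurable.ite (hk (measurableSet_singleton o)) ?_ measurable_const
    fun_prop
  have hp0 : 0 ≤ p := by linarith
  have hab : ∀ a b : ℝ, 0 ≤ a → 0 ≤ b → (a + b) ^ p ≤ 2 ^ p * (a ^ p + b ^ p) := by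
    have aux : ∀ a b : ℝ, 0 ≤ a → 0 ≤ b → a ≤ b → (a + b) ^ p ≤ 2 ^ p * (a ^ p + b ^ p) := by
      intro a b ha hb h
      calc (a + b) ^ p ≤ (2 * b) ^ p := by
            apply Real.rpow_le_rpow (by positivity) (by linarith) hp0
        _ = 2 ^ p * b ^ p := Real.mul_rpow (by norm_num) hb
        _ ≤ _ := by
            gcongr
            have : 0 ≤ a ^ p := by positivity
            linarith
    intro a b ha hb
    rcases le_total a b with h | h
    · exact aux a b ha hb h
    · rw [add_comm a b, add_comm (a ^ p)]; exact aux b a hb ha h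
  have hGb : ∀ x, ‖x‖ ^ p ≤ R ^ p + G x := by
    intro x
    by_cases h : k x = o
    · simp only [hG, if_pos h]
      have : 0 ≤ R ^ p := by positivity
      linarith
    · simp only [hG, if_neg h, add_zero]
      exact Real.rpow_le_rpow (norm_nonneg _) (hRb x h) hp0
  have pt : ∀ x y : E, ‖x - y‖ ^ p ≤ δ ^ p + (if k x ≠ k y then 2 ^ p * (2 * R ^ p) else 0) +
      2 ^ p * (G x + G y) := by
    intro x y
    have hd : 0 ≤ δ ^ p := by positivity
    have h2 : (0 : ℝ) ≤ 2 ^ p := by positivity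
    have h3 : ‖x - y‖ ^ p ≤ 2 ^ p * (‖x‖ ^ p + ‖y‖ ^ p) :=
      (Real.rpow_le_rpow (norm_nonneg _) (norm_sub_le x y) hp0).trans
        (hab _ _ (norm_nonneg _) (norm_nonneg _))
    by_cases h : k x = k y
    · rw [if_neg (by simpa using h)]
      by_cases ho : k x = o
      · have e1 : G x = ‖x‖ ^ p := if_pos ho
        have e2 : G y = ‖y‖ ^ p := if_pos (h ▸ ho)
        rw [e1, e2]; linarith
      · have := Real.rpow_le_rpow (norm_nonneg _) (hcell x y h ho) hp0
        have := mul_nonneg h2 (add_nonneg (hG0 x) (hG0 y))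
        linarith
    · rw [if_pos h]
      have h4 : (2 : ℝ) ^ p * (‖x‖ ^ p + ‖y‖ ^ p) ≤ 2 ^ p * ((R ^ p + G x) + (R ^ p + G y)) := by
        gcongr
        · exact hGb x
        · exact hGb y
      nlinarith
  set B : Set (E × E) := {z | k z.1 ≠ k z.2} with hB
  have hBm : MeasurableSet B := by
    have : MeasurableSet {z : E × E | k z.1 = k z.2} := by
      have e : {z : E × E | k z.1 = k z.2} = ⋃ i, (k ⁻¹' {i}) ×ˢ (k ⁻¹' {i}) := by
        ext z
        simp [eq_comm]
      rw [e]
      exact MeasurableSet.iUnion fun i =>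
        (hk (measurableSet_singleton i)).prod (hk (measurableSet_singleton i))
    exact this.compl
  set c : ℝ := 2 ^ p * (2 * R ^ p) with hc
  have hc0 : 0 ≤ c := by positivity
  have hg1 : Measurable fun z : E × E => ENNReal.ofReal (G z.1) :=
    (hGm.comp measurable_fst).ennreal_ofReal
  have hg2 : Measurable fun z : E × E => ENNReal.ofReal (G z.2) :=
    (hGm.comp measurable_snd).ennreal_ofReal
  have hg3 : Measurable fun z : E × E => ENNReal.ofReal (G z.1) + ENNReal.ofReal (G z.2) :=
    hg1.add hg2
  calc WpPow p Q1 Q2 ≤ ∫⁻ z, ENNReal.ofReal (‖z.1 - z.2‖ ^ p) ∂γ := iInf₂_le γ hγ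
    _ ≤ ∫⁻ z, (ENNReal.ofReal (δ ^ p) + B.indicator (fun _ => ENNReal.ofReal c) z +
          ENNReal.ofReal (2 ^ p) * (ENNReal.ofReal (G z.1) + ENNReal.ofReal (G z.2))) ∂γ := by
        refine lintegral_mono fun z => ?_
        refine (ENNReal.ofReal_le_ofReal (pt z.1 z.2)).trans ?_
        have e : B.indicator (fun _ => ENNReal.ofReal c) z =
            ENNReal.ofReal (if k z.1 ≠ k z.2 then c else 0) := by
          by_cases h : k z.1 = k z.2 <;> simp [Set.indicator, hB, h]
        have hi0 : 0 ≤ (if k z.1 ≠ k z.2 then c else 0) := by split_ifs <;> simp [hc0]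
        rw [e, ← ENNReal.ofReal_add (hG0 _) (hG0 _), ← ENNReal.ofReal_mul (by positivity),
          ← ENNReal.ofReal_add (by positivity) hi0, ← ENNReal.ofReal_add]
        · exact add_nonneg (by positivity) hi0
        · exact mul_nonneg (by positivity) (add_nonneg (hG0 _) (hG0 _))
    _ = ENNReal.ofReal (δ ^ p) + ENNReal.ofReal c * γ B +
          ENNReal.ofReal (2 ^ p) * (∫⁻ x, ENNReal.ofReal (G x) ∂Q1 +
            ∫⁻ x, ENNReal.ofReal (G x) ∂Q2) := by
        rw [lintegral_add_right _ (hg3.const_mul _),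
          lintegral_add_left measurable_const, lintegral_const_mul _ hg3,
          lintegral_add_left hg1, lintegral_indicator_const hBm, lintegral_const, measure_univ,
          mul_one, ← m1, ← m2, lintegral_map hGm.ennreal_ofReal measurable_fst,
          lintegral_map hGm.ennreal_ofReal measurable_snd]
    _ ≤ _ := by gcongr

theorem exists_partition {E : Type*} [NormedAddCommGroup E] [MeasurableSpace E] [BorelSpace E]
    [SecondCountableTopology E] (P : Measure E) [IsProbabilityMeasure P] (p : ℝ) (hp : 1 ≤ p)
    (hmom : HasFinMom p P) (δ : ℝ) (hδ : 0 < δ) (τ : ℝ) (hτ : 0 < τ) :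
    ∃ (N : ℕ) (k : E → Fin (N + 1)) (R : ℝ), Measurable k ∧ 0 ≤ R ∧
      (∀ x y, k x = k y → k x ≠ Fin.last N → ‖x - y‖ ≤ δ) ∧
      (∀ x, k x ≠ Fin.last N → ‖x‖ ≤ R) ∧
      Integrable (fun x => if k x = Fin.last N then ‖x‖ ^ p else 0) P ∧
      ∫ x, (if k x = Fin.last N then ‖x‖ ^ p else 0) ∂P ≤ τ := by
  classical
  have hint : Integrable (fun x : E => ‖x‖ ^ p) P := by
    have hm : Measurable (fun x : E => ‖x‖ ^ p) := by fun_prop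
    refine ⟨hm.aestronglyMeasurable, ?_⟩
    rw [hasFiniteIntegral_iff_ofReal (ae_of_all _ fun x => by positivity)]
    exact lt_top_iff_ne_top.2 hmom
  set u := TopologicalSpace.denseSeq E
  have hu : ∀ x, ∃ i, dist x (u i) < δ / 2 := fun x => by
    obtain ⟨_, h, ⟨i, rfl⟩⟩ := Metric.dense_iff.1 (TopologicalSpace.denseRange_denseSeq E) x (δ / 2)
      (by positivity)
    refine ⟨i, ?_⟩
    rw [dist_comm]; exact h
  set κ : E → ℕ := fun x => Nat.find (hu x) with hκ
  have hκm : Measurable κ := measurable_find hu fun i =>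
    measurableSet_lt (by fun_prop) measurable_const
  have hκs : ∀ x, dist x (u (κ x)) < δ / 2 := fun x => Nat.find_spec (hu x)
  set k : (N : ℕ) → E → Fin (N + 1) := fun N x => ⟨min (κ x) N, by omega⟩ with hkdef
  have hkm : ∀ N, Measurable (k N) := fun N =>
    (measurable_of_countable (fun m : ℕ => (⟨min m N, by omega⟩ : Fin (N + 1)))).comp hκm
  have hlast : ∀ N x, k N x ≠ Fin.last N ↔ κ x < N := by
    intro N x
    simp only [hkdef, ne_eq, Fin.ext_iff, Fin.val_last]
    omega
  have hm : ∀ N, Measurable fun x => if k N x = Fin.last N then ‖x‖ ^ p else 0 := fun N =>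
    Measurable.ite (hkm N (measurableSet_singleton _)) (by fun_prop) measurable_const
  have hbd : ∀ N x, ‖if k N x = Fin.last N then ‖x‖ ^ p else 0‖ ≤ ‖x‖ ^ p := by
    intro N x
    have : 0 ≤ ‖x‖ ^ p := by positivity
    split_ifs
    · rw [Real.norm_of_nonneg this]
    · simpa using this
  have ht : Tendsto (fun N => ∫ x, (if k N x = Fin.last N then ‖x‖ ^ p else 0) ∂P) atTop
      (𝓝 (∫ x, (0 : ℝ) ∂P)) := by
    refine tendsto_integral_of_dominated_convergence _ (fun N => (hm N).aestronglyMeasurable) hint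
      (fun N => ae_of_all _ (hbd N)) (ae_of_all _ fun x => ?_)
    refine tendsto_const_nhds.congr' ?_
    filter_upwards [eventually_gt_atTop (κ x)] with N hN
    rw [if_neg ((hlast N x).2 hN)]
  rw [integral_zero] at ht
  obtain ⟨N, hN⟩ := (ht.eventually (gt_mem_nhds hτ)).exists
  refine ⟨N, k N, ∑ i ∈ Finset.range N, ‖u i‖ + δ, hkm N, by positivity, ?_, ?_, ?_, hN.le⟩
  · intro x y h hx
    have h1 := (hlast N x).1 hx
    have h2 := (hlast N y).1 (h ▸ hx)
    have h3 : κ x = κ y := by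
      simp only [hkdef, Fin.ext_iff] at h
      omega
    have h4 := hκs x
    have h5 := hκs y
    rw [h3] at h4
    rw [← dist_eq_norm]
    have := dist_triangle_right x y (u (κ y))
    linarith
  · intro x hx
    have h1 := (hlast N x).1 hx
    have h2 := hκs x
    have h3 : ‖u (κ x)‖ ≤ ∑ i ∈ Finset.range N, ‖u i‖ :=
      Finset.single_le_sum (f := fun i => ‖u i‖) (fun i _ => norm_nonneg _) (Finset.mem_range.2 h1)
    rw [dist_eq_norm] at h2
    have := norm_le_norm_add_norm_sub' x (u (κ x))
    linarith
  · exact hint.mono' (hm N).aestronglyMeasurable (ae_of_all _ (hbd N))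

theorem null_conv {E : Type*} [NormedAddCommGroup E] [MeasurableSpace E] [BorelSpace E]
    [SecondCountableTopology E] (P : Measure E) [IsProbabilityMeasure P] (p : ℝ) (hp : 1 ≤ p)
    (hmom : HasFinMom p P) (ε : ℝ) (hε : 0 < ε) :
    Tendsto (fun n : ℕ => prodn P n {x | ¬ WpPow p (empDist x) P ≤ ENNReal.ofReal ε})
      atTop (𝓝 0) := by
  set τ : ℝ := ε / (8 * 2 ^ p) with hτ
  have hτpos : 0 < τ := by positivity
  obtain ⟨N, k, R, hk, hR, hcell, hRb, hGi, hGτ⟩ :=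
    exists_partition P p hp hmom ((ε / 4) ^ (1 / p)) (by positivity) τ hτpos
  have hδp : ((ε / 4) ^ (1 / p)) ^ p = ε / 4 := by
    rw [← Real.rpow_mul (by positivity), one_div_mul_cancel (by linarith), Real.rpow_one]
  set c : ℝ := 2 ^ p * (2 * R ^ p) with hc
  have hc0 : 0 ≤ c := by positivity
  set η : ℝ := ε / (4 * ((c + 1) * (N + 1))) with hη
  have hηpos : 0 < η := by positivity
  set G : E → ℝ := fun x => if k x = Fin.last N then ‖x‖ ^ p else 0 with hG
  have hG0 : ∀ x, 0 ≤ G x := fun x => by simp only [hG]; split_ifs <;> positivity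
  have hGm : Measurable G :=
    Measurable.ite (hk (measurableSet_singleton _)) (by fun_prop) measurable_const
  have hA : ∀ i, MeasurableSet (k ⁻¹' {i}) := fun i => hk (measurableSet_singleton i)
  set F : Fin (N + 1) → E → ℝ := fun i => (k ⁻¹' {i}).indicator 1 with hF
  have hFm : ∀ i, Measurable (F i) := fun i => measurable_one.indicator (hA i)
  have w1 := wlln P G hGm hGi τ hτpos
  have w2 := fun i => wlln P (F i) (hFm i) ((integrable_indicator_iff (hA i)).2
    (integrable_const (1 : ℝ)).integrableOn) η hηpos
  have w := w1.add (tendsto_finsetSum Finset.univ fun i _ => w2 i)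
  simp only [Finset.sum_const_zero, add_zero] at w
  refine tendsto_of_tendsto_of_tendsto_of_le_of_le' tendsto_const_nhds w
    (Eventually.of_forall fun _ => zero_le) ?_
  filter_upwards [eventually_gt_atTop 0] with n hn
  have hsub : {x : Fin n → E | ¬ WpPow p (empDist x) P ≤ ENNReal.ofReal ε} ⊆
      {x | τ ≤ |∫ z, G z ∂(empDist x) - ∫ z, G z ∂P|} ∪
      ⋃ i ∈ (Finset.univ : Finset (Fin (N + 1))),
        {x | η ≤ |∫ z, F i z ∂(empDist x) - ∫ z, F i z ∂P|} := by
    intro x hx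
    by_contra hcon
    apply hx
    simp only [Set.mem_union, Set.mem_ofPred_eq, Set.mem_iUnion, not_or, not_exists, not_le,
      Finset.mem_univ, true_and, exists_prop] at hcon
    obtain ⟨c1, c2⟩ := hcon
    have := emp_prob hn x
    refine (upper_bd p hp (empDist x) P k hk (Fin.last N) _ R (by positivity) hR hcell hRb).trans ?_
    rw [hδp]
    have s1 : ∑ i, (P (k ⁻¹' {i}) - (empDist x) (k ⁻¹' {i})) ≤
        ENNReal.ofReal ((N + 1) * η) := by
      have : ∀ i ∈ (Finset.univ : Finset (Fin (N + 1))),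
          P (k ⁻¹' {i}) - (empDist x) (k ⁻¹' {i}) ≤ ENNReal.ofReal η := by
        intro i _
        have h := abs_lt.1 (c2 i)
        simp only [hF, integral_indicator_one (hA i)] at h
        rw [tsub_le_iff_left, ← ofReal_measureReal (μ := P), ← ofReal_measureReal (μ := empDist x),
          ← ENNReal.ofReal_add (by positivity) hηpos.le]
        exact ENNReal.ofReal_le_ofReal (by linarith [h.1])
      refine (Finset.sum_le_card_nsmul _ _ _ this).trans ?_
      rw [Finset.card_univ, Fintype.card_fin, nsmul_eq_mul, ENNReal.ofReal_mul (by positivity)]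
      gcongr
      rw [← ENNReal.ofReal_natCast]
      push_cast
      exact le_rfl
    have s2 : ∫⁻ z, ENNReal.ofReal (G z) ∂(empDist x) ≤ ENNReal.ofReal (2 * τ) := by
      rw [← ofReal_integral_eq_lintegral_ofReal (emp_integrable hn x G hGm) (ae_of_all _ hG0)]
      refine ENNReal.ofReal_le_ofReal ?_
      have := (abs_lt.1 c1).2
      linarith
    have s3 : ∫⁻ z, ENNReal.ofReal (G z) ∂P ≤ ENNReal.ofReal τ := by
      rw [← ofReal_integral_eq_lintegral_ofReal hGi (ae_of_all _ hG0)]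
      exact ENNReal.ofReal_le_ofReal hGτ
    calc _ ≤ ENNReal.ofReal (ε / 4) + ENNReal.ofReal c * ENNReal.ofReal ((N + 1) * η) +
          ENNReal.ofReal (2 ^ p) * (ENNReal.ofReal (2 * τ) + ENNReal.ofReal τ) := by gcongr
      _ = ENNReal.ofReal (ε / 4 + c * ((N + 1) * η) + 2 ^ p * (2 * τ + τ)) := by
          rw [← ENNReal.ofReal_mul hc0, ← ENNReal.ofReal_add (by positivity) (by positivity),
            ← ENNReal.ofReal_add (by positivity) hτpos.le, ← ENNReal.ofReal_mul (by positivity),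
            ← ENNReal.ofReal_add (by positivity) (by positivity)]
      _ ≤ ENNReal.ofReal ε := by
          refine ENNReal.ofReal_le_ofReal ?_
          have e1 : (2 : ℝ) ^ p * (2 * τ + τ) = 3 * ε / 8 := by
            rw [hτ]; field_simp; ring
          have e2 : c * ((N + 1) * η) ≤ ε / 4 := by
            have : (c + 1) * ((N + 1) * η) = ε / 4 := by rw [hη]; field_simp
            have h0 : 0 ≤ ((N : ℝ) + 1) * η := by positivity
            nlinarith
          linarith
  refine (measure_mono hsub).trans ((measure_union_le _ _).trans ?_)
  gcongr
  exact measure_biUnion_finset_le _ _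

/-- Consistency of the Wasserstein GoF test against any fixed alternative
`P ≠ P₀`: with `T_n = W_p^p(P̂_n, P₀)` and critical value
`c(α,n,P₀) = inf {t > 0 : P₀ⁿ[T_n ≤ t] ≥ 1 - α}`, one has
`Pⁿ[T_n ≥ c(α,n,P₀)] → 1` as `n → ∞`, for every `α ∈ (0,1)`. -/
theorem wasserstein_simple_GoF_test_consistent {d : ℕ} (p : ℝ) (hp : 1 ≤ p)
    (P₀ P : Measure (Euc d)) [IsProbabilityMeasure P₀] [IsProbabilityMeasure P]
    (hmom₀ : HasFinMom p P₀) (hne : P ≠ P₀)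
    (α : ℝ) (hα : α ∈ Set.Ioo (0 : ℝ) 1) :
    Tendsto (fun n : ℕ =>
        prodn P n {x |
          ENNReal.ofReal
              (sInf {t : ℝ | 0 < t ∧
                ENNReal.ofReal (1 - α) ≤
                  prodn P₀ n {y | WpPow p (empDist y) P₀ ≤ ENNReal.ofReal t}})
            ≤ WpPow p (empDist x) P₀})
      atTop (𝓝 1) := by
  obtain ⟨f, L, hL, hb, hfne⟩ := sep_fun P P₀ hne
  have hη : 0 < |∫ x, f x ∂P - ∫ x, f x ∂P₀| / 2 := by
    have := abs_pos.2 (sub_ne_zero.2 hfne)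
    positivity
  set η := |∫ x, f x ∂P - ∫ x, f x ∂P₀| / 2 with hηdef
  obtain ⟨ε, hε, hlow⟩ := lower_bd p hp f L hL hb η hη
  have hfm : Measurable f := hL.continuous.measurable
  have hfi : Integrable f P :=
    .of_bound hfm.aestronglyMeasurable 1 (ae_of_all _ fun x => by simpa using hb x)
  have w := wlln P f hfm hfi η hη
  have w0 := null_conv P₀ p hp hmom₀ ε hε
  have hpr : ∀ (Q : Measure (Euc d)) [IsProbabilityMeasure Q] (n : ℕ),
      IsProbabilityMeasure (prodn Q n) := fun Q _ n => by unfold prodn; infer_instance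
  have hcov : ∀ (Q : Measure (Euc d)) [IsProbabilityMeasure Q] (n : ℕ) (s t : Set (Fin n → Euc d)),
      (∀ x, x ∉ t → x ∈ s) → 1 - prodn Q n t ≤ prodn Q n s := by
    intro Q _ n s t h
    have := hpr Q n
    rw [tsub_le_iff_right, ← measure_univ (μ := prodn Q n)]
    refine le_trans (measure_mono ?_) (measure_union_le s t)
    intro x _
    by_cases hx : x ∈ t
    · exact Or.inr hx
    · exact Or.inl (h x hx)
  have lim : Tendsto (fun n : ℕ =>
      1 - prodn P n {x | η ≤ |∫ z, f z ∂(empDist x) - ∫ z, f z ∂P|}) atTop (𝓝 1) := by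
    have := ENNReal.Tendsto.sub (tendsto_const_nhds (x := (1 : ℝ≥0∞))) w (Or.inl (by simp))
    simpa using this
  refine tendsto_of_tendsto_of_tendsto_of_le_of_le' lim tendsto_const_nhds ?_
    (Eventually.of_forall fun n => by have := hpr P n; exact prob_le_one)
  have hαpos : (0 : ℝ≥0∞) < ENNReal.ofReal α := ENNReal.ofReal_pos.2 hα.1
  filter_upwards [eventually_gt_atTop 0, w0.eventually (gt_mem_nhds hαpos)] with n hn hn0
  refine hcov P n _ _ fun x hx => ?_
  have hx' : |∫ z, f z ∂(empDist x) - ∫ z, f z ∂P| < η := not_le.1 hx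
  have := emp_prob hn x
  refine le_trans (ENNReal.ofReal_le_ofReal ?_) (hlow (empDist x) P₀ this inferInstance ?_)
  · refine csInf_le ⟨0, fun t ht => ht.1.le⟩ ⟨hε, ?_⟩
    refine le_trans ?_ (hcov P₀ n _ {y | ¬ WpPow p (empDist y) P₀ ≤ ENNReal.ofReal ε}
      fun y hy => not_not.1 hy)
    rw [ENNReal.ofReal_sub _ hα.1.le, ENNReal.ofReal_one]
    exact tsub_le_tsub_left hn0.le 1
  · have h1 : |∫ x, f x ∂P - ∫ x, f x ∂P₀| = 2 * η := by rw [hηdef]; ring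
    have h2 := abs_sub_le (∫ x, f x ∂P) (∫ z, f z ∂(empDist x)) (∫ x, f x ∂P₀)
    rw [abs_sub_comm (∫ x, f x ∂P) (∫ z, f z ∂(empDist x))] at h2
    linarith
end
end
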